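/- Let (X,T) be a nonautonomous dynamical system, K ⊂ X_0 a non-empty compact set, and f = (f_k) an equicontinuous sequence of continuous real-valued potentials. Then P^B(T,f,K) = sup{ P̲_μ(T,f) : μ is a Borel probability measure on X_0 with μ(K) = 1 }. -/

import Mathlib

open Filter MeasureTheory Set
open scoped ENNReal Topology

namespace NDS

variable {X : ℕ → Type*}

/-- Iterates `T^j : X 0 → X j` of a nonautonomous dynamical system `T`. -/
def iter (T : ∀ k, X k → X (k + 1)) : ∀ j, X 0 → X j
  | 0 => fun x => x
  | j + 1 => fun x => T j (iter T j x)

/-- The Birkhoff-type sum `S_n^T f (x) = ∑_{j<n} f_j (T^j x)`. -/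
def birk (T : ∀ k, X k → X (k + 1)) (f : ∀ k, X k → ℝ) (n : ℕ) (x : X 0) : ℝ :=
  ∑ j ∈ Finset.range n, f j (iter T j x)

/-- The uniform norm `‖f‖ = sup_k sup_x |f_k x|` of a sequence of potentials. -/
noncomputable def fnorm (f : ∀ k, X k → ℝ) : ℝ :=
  ⨆ k : ℕ, ⨆ x : X k, |f k x|

/-- `log : ℝ≥0∞ → EReal` with the conventions `log 0 = -∞`, `log ∞ = ∞`. -/
noncomputable def elog (x : ℝ≥0∞) : EReal :=
  if x = 0 then ⊥ else if x = ⊤ then ⊤ else ((Real.log x.toReal : ℝ) : EReal)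

/-- The nonnegative part of an extended real, as an element of `ℝ≥0∞`. -/
noncomputable def toENN (x : EReal) : ℝ≥0∞ :=
  if x = ⊤ then ⊤ else ENNReal.ofReal x.toReal

/-- The canonical map `ℝ≥0∞ → EReal`. -/
noncomputable def ofENN (x : ℝ≥0∞) : EReal :=
  if x = ⊤ then ⊤ else ((x.toReal : ℝ) : EReal)

/-- The integral of an extended-real-valued function: the difference of the lower
integrals of its positive and negative parts. -/
noncomputable def eInt {α : Type*} [MeasurableSpace α] (μ : Measure α) (g : α → EReal) : EReal :=
  ofENN (∫⁻ x, toENN (g x) ∂μ) - ofENN (∫⁻ x, toENN (-g x) ∂μ)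

section Metric

variable [∀ k, MetricSpace (X k)]

/-- The open Bowen ball `B_n^T(x,ε)`. -/
def bowenBall (T : ∀ k, X k → X (k + 1)) (n : ℕ) (ε : ℝ) (x : X 0) : Set (X 0) :=
  {y | ∀ j < n, dist (iter T j x) (iter T j y) < ε}

/-- The closed Bowen ball `B̄_n^T(x,ε)`. -/
def bowenClosedBall (T : ∀ k, X k → X (k + 1)) (n : ℕ) (ε : ℝ) (x : X 0) : Set (X 0) :=
  {y | ∀ j < n, dist (iter T j x) (iter T j y) ≤ ε}

/-- Equicontinuity of a sequence of potentials `f = (f_k)`. -/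
def EquicontPotential (f : ∀ k, X k → ℝ) : Prop :=
  ∀ ε : ℝ, 0 < ε → ∃ δ : ℝ, 0 < δ ∧ ∀ k, ∀ x y : X k, dist x y < δ → |f k x - f k y| < ε

/-- The supremum of the Birkhoff sum `S_n^T f` over a subset `A` of `X 0`. -/
noncomputable def supBirk (T : ∀ k, X k → X (k + 1)) (f : ∀ k, X k → ℝ) (n : ℕ)
    (A : Set (X 0)) : ℝ :=
  ⨆ y : A, birk T f n (y : X 0)

/-- Measure-theoretic lower local pressure `P̲_μ(T,f,x)`. -/
noncomputable def localLowerPres [MeasurableSpace (X 0)] (μ : Measure (X 0))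
    (T : ∀ k, X k → X (k + 1)) (f : ∀ k, X k → ℝ) (x : X 0) : EReal :=
  ⨆ (ε : ℝ) (_ : 0 < ε),
    liminf (fun n : ℕ =>
      (((n : ℝ)⁻¹ : ℝ) : EReal) *
        (-(elog (μ (bowenBall T n ε x))) + ((birk T f n x : ℝ) : EReal))) atTop

/-- Measure-theoretic upper local pressure `P̄_μ(T,f,x)`. -/
noncomputable def localUpperPres [MeasurableSpace (X 0)] (μ : Measure (X 0))
    (T : ∀ k, X k → X (k + 1)) (f : ∀ k, X k → ℝ) (x : X 0) : EReal :=
  ⨆ (ε : ℝ) (_ : 0 < ε),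
    limsup (fun n : ℕ =>
      (((n : ℝ)⁻¹ : ℝ) : EReal) *
        (-(elog (μ (bowenBall T n ε x))) + ((birk T f n x : ℝ) : EReal))) atTop

/-- Measure-theoretic lower local entropy `h̲_μ(T,x)`. -/
noncomputable def localLowerEnt [MeasurableSpace (X 0)] (μ : Measure (X 0))
    (T : ∀ k, X k → X (k + 1)) (x : X 0) : EReal :=
  ⨆ (ε : ℝ) (_ : 0 < ε),
    liminf (fun n : ℕ =>
      (((n : ℝ)⁻¹ : ℝ) : EReal) * (-(elog (μ (bowenBall T n ε x))))) atTop

/-- Measure-theoretic upper local entropy `h̄_μ(T,x)`. -/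
noncomputable def localUpperEnt [MeasurableSpace (X 0)] (μ : Measure (X 0))
    (T : ∀ k, X k → X (k + 1)) (x : X 0) : EReal :=
  ⨆ (ε : ℝ) (_ : 0 < ε),
    limsup (fun n : ℕ =>
      (((n : ℝ)⁻¹ : ℝ) : EReal) * (-(elog (μ (bowenBall T n ε x))))) atTop

/-- Measure-theoretic lower pressure `P̲_μ(T,f) = ∫ P̲_μ(T,f,x) dμ(x)`. -/
noncomputable def lowerPres [MeasurableSpace (X 0)] (μ : Measure (X 0))
    (T : ∀ k, X k → X (k + 1)) (f : ∀ k, X k → ℝ) : EReal :=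
  eInt μ (fun x => localLowerPres μ T f x)

/-- Measure-theoretic upper pressure `P̄_μ(T,f) = ∫ P̄_μ(T,f,x) dμ(x)`. -/
noncomputable def upperPres [MeasurableSpace (X 0)] (μ : Measure (X 0))
    (T : ∀ k, X k → X (k + 1)) (f : ∀ k, X k → ℝ) : EReal :=
  eInt μ (fun x => localUpperPres μ T f x)

/-- Measure-theoretic lower entropy `h̲_μ(T) = ∫ h̲_μ(T,x) dμ(x)`. -/
noncomputable def lowerEnt [MeasurableSpace (X 0)] (μ : Measure (X 0))
    (T : ∀ k, X k → X (k + 1)) : EReal :=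
  eInt μ (fun x => localLowerEnt μ T x)

/-- Measure-theoretic upper entropy `h̄_μ(T) = ∫ h̄_μ(T,x) dμ(x)`. -/
noncomputable def upperEnt [MeasurableSpace (X 0)] (μ : Measure (X 0))
    (T : ∀ k, X k → X (k + 1)) : EReal :=
  eInt μ (fun x => localUpperEnt μ T x)

/-- The Bowen premeasure `M^s_{N,ε}(T,f,Z)`: the infimum of
`∑ exp(-n_i s + S_{n_i}^T f(x_i))` over all countable `(N,ε)`-covers of `Z` by open
Bowen balls `B_{n_i}^T(x_i,ε)` with `n_i ≥ N`. -/
noncomputable def bowenPre (T : ∀ k, X k → X (k + 1)) (f : ∀ k, X k → ℝ)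
    (s : ℝ) (N : ℕ) (ε : ℝ) (Z : Set (X 0)) : ℝ≥0∞ :=
  ⨅ (D : Set (X 0 × ℕ)) (_ : D.Countable) (_ : ∀ p ∈ D, N ≤ p.2)
      (_ : Z ⊆ ⋃ p ∈ D, bowenBall T p.2 ε p.1),
    ∑' p : D, ENNReal.ofReal (Real.exp (-(p.1.2 : ℝ) * s + birk T f p.1.2 p.1.1))

/-- `M^s_ε(T,f,Z) = lim_{N→∞} M^s_{N,ε}(T,f,Z)` (an increasing limit). -/
noncomputable def bowenPreLim (T : ∀ k, X k → X (k + 1)) (f : ∀ k, X k → ℝ)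
    (s : ℝ) (ε : ℝ) (Z : Set (X 0)) : ℝ≥0∞ :=
  ⨆ N : ℕ, bowenPre T f s N ε Z

/-- The critical value `P^B(T,f,Z,ε) = inf {s : M^s_ε(T,f,Z) = 0}`. -/
noncomputable def bowenCrit (T : ∀ k, X k → X (k + 1)) (f : ∀ k, X k → ℝ)
    (ε : ℝ) (Z : Set (X 0)) : EReal :=
  ⨅ (s : ℝ) (_ : bowenPreLim T f s ε Z = 0), (s : EReal)

/-- The Bowen (Pesin–Pitskel') topological pressure
`P^B(T,f,Z) = lim_{ε→0} P^B(T,f,Z,ε)` (an increasing limit as `ε ↓ 0`). -/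
noncomputable def bowenP (T : ∀ k, X k → X (k + 1)) (f : ∀ k, X k → ℝ)
    (Z : Set (X 0)) : EReal :=
  ⨆ (ε : ℝ) (_ : 0 < ε), bowenCrit T f ε Z

/-- The Bowen topological entropy `h^B(T,Z) = P^B(T,0,Z)`. -/
noncomputable def bowenEnt (T : ∀ k, X k → X (k + 1)) (Z : Set (X 0)) : EReal :=
  bowenP T (fun k => fun _ : X k => (0 : ℝ)) Z

/-- The premeasure `N^s_{N,ε}(T,f,Z)` using suprema of Birkhoff sums over the balls. -/
noncomputable def nBowenPre (T : ∀ k, X k → X (k + 1)) (f : ∀ k, X k → ℝ)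
    (s : ℝ) (N : ℕ) (ε : ℝ) (Z : Set (X 0)) : ℝ≥0∞ :=
  ⨅ (D : Set (X 0 × ℕ)) (_ : D.Countable) (_ : ∀ p ∈ D, N ≤ p.2)
      (_ : Z ⊆ ⋃ p ∈ D, bowenBall T p.2 ε p.1),
    ∑' p : D, ENNReal.ofReal
      (Real.exp (-(p.1.2 : ℝ) * s + supBirk T f p.1.2 (bowenBall T p.1.2 ε p.1.1)))

/-- `N^s_ε(T,f,Z) = lim_{N→∞} N^s_{N,ε}(T,f,Z)`. -/
noncomputable def nBowenPreLim (T : ∀ k, X k → X (k + 1)) (f : ∀ k, X k → ℝ)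
    (s : ℝ) (ε : ℝ) (Z : Set (X 0)) : ℝ≥0∞ :=
  ⨆ N : ℕ, nBowenPre T f s N ε Z

/-- The critical value `Q^B(T,f,Z,ε) = inf {s : N^s_ε(T,f,Z) = 0}`. -/
noncomputable def nBowenCrit (T : ∀ k, X k → X (k + 1)) (f : ∀ k, X k → ℝ)
    (ε : ℝ) (Z : Set (X 0)) : EReal :=
  ⨅ (s : ℝ) (_ : nBowenPreLim T f s ε Z = 0), (s : EReal)

/-- The weighted Bowen premeasure `W^s_{N,ε}(T,f,g)`: the infimum of
`∑ c_i exp(-n_i s + sup_{B_{n_i}^T(x_i,ε)} S_{n_i}^T f)` over all countable families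
`{(B_{n_i}^T(x_i,ε), c_i)}` with `0 < c_i`, `n_i ≥ N` and `∑ c_i χ_{B_i} ≥ g`. -/
noncomputable def wBowenPre (T : ∀ k, X k → X (k + 1)) (f : ∀ k, X k → ℝ)
    (s : ℝ) (N : ℕ) (ε : ℝ) (g : X 0 → ℝ) : ℝ≥0∞ :=
  ⨅ (D : Set ((X 0 × ℕ) × ℝ)) (_ : D.Countable)
      (_ : ∀ p ∈ D, N ≤ p.1.2 ∧ 0 < p.2)
      (_ : ∀ x : X 0, ENNReal.ofReal (g x) ≤
        ∑' p : D, (bowenBall T p.1.1.2 ε p.1.1.1).indicator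
          (fun _ => ENNReal.ofReal p.1.2) x),
    ∑' p : D, ENNReal.ofReal p.1.2 *
      ENNReal.ofReal
        (Real.exp (-(p.1.1.2 : ℝ) * s + supBirk T f p.1.1.2 (bowenBall T p.1.1.2 ε p.1.1.1)))

/-- `D` is a countable `(N,ε)`-packing of `Z`: the closed Bowen balls
`B̄_{n}^T(x,ε)`, `(x,n) ∈ D`, are pairwise disjoint with centers in `Z` and orders `≥ N`. -/
def IsPacking (T : ∀ k, X k → X (k + 1)) (N : ℕ) (ε : ℝ) (Z : Set (X 0))
    (D : Set (X 0 × ℕ)) : Prop :=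
  D.Countable ∧ (∀ p ∈ D, p.1 ∈ Z ∧ N ≤ p.2) ∧
    ∀ p ∈ D, ∀ q ∈ D, p ≠ q →
      Disjoint (bowenClosedBall T p.2 ε p.1) (bowenClosedBall T q.2 ε q.1)

/-- The packing premeasure `P^s_{N,ε}(T,f,Z)`: the supremum of
`∑ exp(-n_i s + S_{n_i}^T f(x_i))` over all countable `(N,ε)`-packings of `Z`. -/
noncomputable def packPre (T : ∀ k, X k → X (k + 1)) (f : ∀ k, X k → ℝ)
    (s : ℝ) (N : ℕ) (ε : ℝ) (Z : Set (X 0)) : ℝ≥0∞ :=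
  ⨆ (D : Set (X 0 × ℕ)) (_ : IsPacking T N ε Z D),
    ∑' p : D, ENNReal.ofReal (Real.exp (-(p.1.2 : ℝ) * s + birk T f p.1.2 p.1.1))

/-- `P^s_{∞,ε}(T,f,Z) = lim_{N→∞} P^s_{N,ε}(T,f,Z)` (a decreasing limit). -/
noncomputable def packPreInf (T : ∀ k, X k → X (k + 1)) (f : ∀ k, X k → ℝ)
    (s : ℝ) (ε : ℝ) (Z : Set (X 0)) : ℝ≥0∞ :=
  ⨅ N : ℕ, packPre T f s N ε Z

/-- The packing measure-like quantity
`P^s_ε(T,f,Z) = inf { ∑_i P^s_{∞,ε}(T,f,Z_i) : Z ⊆ ⋃_i Z_i }`. -/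
noncomputable def packMeasure (T : ∀ k, X k → X (k + 1)) (f : ∀ k, X k → ℝ)
    (s : ℝ) (ε : ℝ) (Z : Set (X 0)) : ℝ≥0∞ :=
  ⨅ (Zs : ℕ → Set (X 0)) (_ : Z ⊆ ⋃ i, Zs i), ∑' i, packPreInf T f s ε (Zs i)

/-- The critical value `P^P(T,f,Z,ε) = inf {s : P^s_ε(T,f,Z) = 0}`. -/
noncomputable def packCrit (T : ∀ k, X k → X (k + 1)) (f : ∀ k, X k → ℝ)
    (ε : ℝ) (Z : Set (X 0)) : EReal :=
  ⨅ (s : ℝ) (_ : packMeasure T f s ε Z = 0), (s : EReal)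

/-- The packing topological pressure `P^P(T,f,Z) = lim_{ε→0} P^P(T,f,Z,ε)`. -/
noncomputable def packP (T : ∀ k, X k → X (k + 1)) (f : ∀ k, X k → ℝ)
    (Z : Set (X 0)) : EReal :=
  ⨆ (ε : ℝ) (_ : 0 < ε), packCrit T f ε Z

/-- The packing topological entropy `h^P(T,Z) = P^P(T,0,Z)`. -/
noncomputable def packEnt (T : ∀ k, X k → X (k + 1)) (Z : Set (X 0)) : EReal :=
  packP T (fun k => fun _ : X k => (0 : ℝ)) Z

/-- The packing premeasure `Q^s_{N,ε}(T,f,Z)` using suprema of Birkhoff sums over the balls. -/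
noncomputable def qPackPre (T : ∀ k, X k → X (k + 1)) (f : ∀ k, X k → ℝ)
    (s : ℝ) (N : ℕ) (ε : ℝ) (Z : Set (X 0)) : ℝ≥0∞ :=
  ⨆ (D : Set (X 0 × ℕ)) (_ : IsPacking T N ε Z D),
    ∑' p : D, ENNReal.ofReal
      (Real.exp (-(p.1.2 : ℝ) * s + supBirk T f p.1.2 (bowenClosedBall T p.1.2 ε p.1.1)))

/-- `Q^s_{∞,ε}(T,f,Z) = lim_{N→∞} Q^s_{N,ε}(T,f,Z)`. -/
noncomputable def qPackPreInf (T : ∀ k, X k → X (k + 1)) (f : ∀ k, X k → ℝ)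
    (s : ℝ) (ε : ℝ) (Z : Set (X 0)) : ℝ≥0∞ :=
  ⨅ N : ℕ, qPackPre T f s N ε Z

/-- `Q^s_ε(T,f,Z) = inf { ∑_i Q^s_{∞,ε}(T,f,Z_i) : Z ⊆ ⋃_i Z_i }`. -/
noncomputable def qPackMeasure (T : ∀ k, X k → X (k + 1)) (f : ∀ k, X k → ℝ)
    (s : ℝ) (ε : ℝ) (Z : Set (X 0)) : ℝ≥0∞ :=
  ⨅ (Zs : ℕ → Set (X 0)) (_ : Z ⊆ ⋃ i, Zs i), ∑' i, qPackPreInf T f s ε (Zs i)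

/-- The critical value `Q^P(T,f,Z,ε) = inf {s : Q^s_ε(T,f,Z) = 0}`. -/
noncomputable def qPackCrit (T : ∀ k, X k → X (k + 1)) (f : ∀ k, X k → ℝ)
    (ε : ℝ) (Z : Set (X 0)) : EReal :=
  ⨅ (s : ℝ) (_ : qPackMeasure T f s ε Z = 0), (s : EReal)

end Metric

/-- The distance function of an explicitly given metric space structure. -/
def mdist {α : Type*} (m : MetricSpace α) (x y : α) : ℝ :=
  @dist α m.toPseudoMetricSpace.toDist x y

end NDS

namespace NDS

open scoped NNReal

section Frostman

variable {Y ι : Type*}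

/-- The total weight at `x` of the weighted family `c` of the sets `U i`. -/
noncomputable def weightAt (U : ι → Set Y) (c : ι →₀ ℝ≥0) (x : Y) : ℝ :=
  Finsupp.linearCombination ℝ≥0 (fun i => (U i).indicator (fun _ => (1 : ℝ)) x) c

/-- The total cost of the weighted family `c` when the `i`-th set has cost `w i`. -/
noncomputable def weightCost (w : ι → ℝ) (c : ι →₀ ℝ≥0) : ℝ :=
  Finsupp.linearCombination ℝ≥0 w c

lemma weightAt_eq_sum (U : ι → Set Y) (c : ι →₀ ℝ≥0) (x : Y) :
    weightAt U c x = ∑ i ∈ c.support, (c i : ℝ) * (U i).indicator (fun _ => (1 : ℝ)) x := by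
  simp [weightAt, Finsupp.linearCombination_apply, Finsupp.sum, NNReal.smul_def]

lemma weightCost_eq_sum (w : ι → ℝ) (c : ι →₀ ℝ≥0) :
    weightCost w c = ∑ i ∈ c.support, (c i : ℝ) * w i := by
  simp [weightCost, Finsupp.linearCombination_apply, Finsupp.sum, NNReal.smul_def]

lemma weightAt_nonneg (U : ι → Set Y) (c : ι →₀ ℝ≥0) (x : Y) : 0 ≤ weightAt U c x := by
  rw [weightAt_eq_sum]
  exact Finset.sum_nonneg fun i _ =>
    mul_nonneg (c i).2 (indicator_nonneg (fun _ _ => zero_le_one) _)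

lemma weightCost_nonneg {w : ι → ℝ} (hw : ∀ i, 0 ≤ w i) (c : ι →₀ ℝ≥0) :
    0 ≤ weightCost w c := by
  rw [weightCost_eq_sum]
  exact Finset.sum_nonneg fun i _ => mul_nonneg (c i).2 (hw i)

/-- The costs of the finite weighted families dominating `g` on `K`. -/
def costSet (U : ι → Set Y) (w : ι → ℝ) (K : Set Y) (g : Y → ℝ) : Set ℝ :=
  weightCost w '' {c | ∀ x ∈ K, g x ≤ weightAt U c x}

/-- The least cost of a finite weighted family dominating `g` on `K`. -/
noncomputable def minCost (U : ι → Set Y) (w : ι → ℝ) (K : Set Y) (g : Y → ℝ) : ℝ :=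
  sInf (costSet U w K g)

lemma bddBelow_costSet (U : ι → Set Y) {w : ι → ℝ} (hw : ∀ i, 0 ≤ w i) (K : Set Y)
    (g : Y → ℝ) : BddBelow (costSet U w K g) := by
  refine ⟨0, ?_⟩
  rintro _ ⟨c, -, rfl⟩
  exact weightCost_nonneg hw c

lemma minCost_le (U : ι → Set Y) {w : ι → ℝ} (hw : ∀ i, 0 ≤ w i) {K : Set Y}
    {g : Y → ℝ} {c : ι →₀ ℝ≥0} (hc : ∀ x ∈ K, g x ≤ weightAt U c x) :
    minCost U w K g ≤ weightCost w c :=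
  csInf_le (bddBelow_costSet U hw K g) ⟨c, hc, rfl⟩

lemma minCost_nonneg (U : ι → Set Y) {w : ι → ℝ} (hw : ∀ i, 0 ≤ w i) (K : Set Y)
    (g : Y → ℝ) : 0 ≤ minCost U w K g := by
  refine Real.sInf_nonneg ?_
  rintro _ ⟨c, -, rfl⟩
  exact weightCost_nonneg hw c

lemma minCost_nonpos (U : ι → Set Y) {w : ι → ℝ} (hw : ∀ i, 0 ≤ w i) {K : Set Y}
    {g : Y → ℝ} (hg : ∀ x ∈ K, g x ≤ 0) : minCost U w K g ≤ 0 := by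
  simpa [weightCost] using minCost_le U hw (K := K) (g := g) (c := 0)
    (fun x hx => (hg x hx).trans (weightAt_nonneg U 0 x))

lemma minCost_le_of_le_indicator {U : ι → Set Y} {w : ι → ℝ} (hw : ∀ i, 0 ≤ w i) {K : Set Y}
    {g : Y → ℝ} (i : ι) (hg : ∀ x, g x ≤ (U i).indicator (fun _ => (1 : ℝ)) x) :
    minCost U w K g ≤ w i := by
  simpa [weightCost] using minCost_le U hw (K := K) (g := g) (c := Finsupp.single i 1)
    (fun x _ => by simpa [weightAt] using hg x)

lemma minCost_smul_le {U : ι → Set Y} {w : ι → ℝ} (hw : ∀ i, 0 ≤ w i) {K : Set Y}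
    {g : Y → ℝ} (hne : (costSet U w K g).Nonempty) {a : ℝ} (ha : 0 < a) :
    minCost U w K (fun x => a * g x) ≤ a * minCost U w K g := by
  lift a to ℝ≥0 using ha.le
  rw [← div_le_iff₀' ha]
  refine le_csInf hne ?_
  rintro _ ⟨c, hc, rfl⟩
  rw [div_le_iff₀' ha]
  have : weightCost w (a • c) = a * weightCost w c := by
    simp [weightCost, NNReal.smul_def]
  rw [← this]
  refine minCost_le U hw fun x hx => ?_
  have : weightAt U (a • c) x = a * weightAt U c x := by
    simp [weightAt, NNReal.smul_def]
  rw [this]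
  exact mul_le_mul_of_nonneg_left (hc x hx) a.2

lemma minCost_smul {U : ι → Set Y} {w : ι → ℝ} (hw : ∀ i, 0 ≤ w i) {K : Set Y}
    {g : Y → ℝ} {a : ℝ} (ha : 0 < a) (hne : (costSet U w K g).Nonempty)
    (hne' : (costSet U w K (fun x => a * g x)).Nonempty) :
    minCost U w K (fun x => a * g x) = a * minCost U w K g := by
  refine (minCost_smul_le hw hne ha).antisymm ?_
  have h := minCost_smul_le hw hne' (inv_pos.2 ha)
  simp only [inv_mul_cancel_left₀ ha.ne'] at h
  rwa [inv_mul_eq_div, le_div_iff₀' ha] at h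

lemma minCost_add_le {U : ι → Set Y} {w : ι → ℝ} (hw : ∀ i, 0 ≤ w i) {K : Set Y}
    {g h : Y → ℝ} (hg : (costSet U w K g).Nonempty) (hh : (costSet U w K h).Nonempty) :
    minCost U w K (fun x => g x + h x) ≤ minCost U w K g + minCost U w K h := by
  rw [← sub_le_iff_le_add]
  refine le_csInf hg ?_
  rintro _ ⟨c, hc, rfl⟩
  rw [sub_le_comm]
  refine le_csInf hh ?_
  rintro _ ⟨c', hc', rfl⟩
  rw [sub_le_iff_le_add']
  have : weightCost w (c + c') = weightCost w c + weightCost w c' := by simp [weightCost]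
  rw [← this]
  refine minCost_le U hw fun x hx => ?_
  have : weightAt U (c + c') x = weightAt U c x + weightAt U c' x := by simp [weightAt]
  rw [this]
  exact add_le_add (hc x hx) (hc' x hx)

lemma costSet_nonempty [TopologicalSpace Y] {U : ι → Set Y} (hU : ∀ i, IsOpen (U i))
    (w : ι → ℝ) {K : Set Y} (hK : IsCompact K) (hcov : K ⊆ ⋃ i, U i) {g : Y → ℝ}
    (hg : Continuous g) : (costSet U w K g).Nonempty := by
  classical
  obtain ⟨t, ht⟩ := hK.elim_finite_subcover U hU hcov
  obtain ⟨C, hC⟩ := hK.bddAbove_image hg.continuousOn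
  refine ⟨_, ∑ i ∈ t, Finsupp.single i C.toNNReal, fun x hx => ?_, rfl⟩
  have h1 : g x ≤ C.toNNReal := (hC ⟨x, hx, rfl⟩).trans (Real.le_coe_toNNReal C)
  obtain ⟨i, hi, hxi⟩ := mem_iUnion₂.1 (ht hx)
  have h2 : weightAt U (∑ i ∈ t, Finsupp.single i C.toNNReal) x
      = ∑ i ∈ t, (C.toNNReal : ℝ) * (U i).indicator (fun _ => (1 : ℝ)) x := by
    simp [weightAt, NNReal.smul_def]
  rw [h2]
  refine h1.trans ?_
  calc (C.toNNReal : ℝ) = (C.toNNReal : ℝ) * (U i).indicator (fun _ => (1 : ℝ)) x := by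
        simp [hxi]
    _ ≤ _ := Finset.single_le_sum
        (f := fun i => (C.toNNReal : ℝ) * (U i).indicator (fun _ => (1 : ℝ)) x)
        (fun j _ => mul_nonneg C.toNNReal.2 (indicator_nonneg (fun _ _ => zero_le_one) _)) hi

/-- A Frostman-type lemma: if every finite weighted family of the open sets `U i` dominating `1`
on the compact set `K` costs at least `a > 0`, then `K` carries a probability measure giving
mass at most `w i / a` to each `U i`. -/
lemma exists_measure_le_of_le_weightCost [TopologicalSpace Y] [T2Space Y] [CompactSpace Y]
    [MeasurableSpace Y] [BorelSpace Y] {U : ι → Set Y} (hU : ∀ i, IsOpen (U i)) {w : ι → ℝ}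
    (hw : ∀ i, 0 ≤ w i) {K : Set Y} (hK : IsCompact K) (hcov : K ⊆ ⋃ i, U i) {a : ℝ} (ha : 0 < a)
    (h : ∀ c : ι →₀ ℝ≥0, (∀ x ∈ K, 1 ≤ weightAt U c x) → a ≤ weightCost w c) :
    ∃ μ : Measure Y, IsProbabilityMeasure μ ∧ μ K = 1 ∧
      ∀ i, μ (U i) ≤ ENNReal.ofReal (w i / a) := by
  have hKne : K.Nonempty := by
    by_contra hne
    rw [not_nonempty_iff_eq_empty] at hne
    have := h 0 (by simp [hne])
    simp [weightCost] at this
    linarith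
  let p : CompactlySupportedContinuousMap Y ℝ → ℝ := fun g => minCost U w K g
  have hne' : ∀ g : CompactlySupportedContinuousMap Y ℝ, (costSet U w K g).Nonempty := fun g =>
    costSet_nonempty hU w hK hcov g.continuous
  let one : CompactlySupportedContinuousMap Y ℝ :=
    CompactlySupportedContinuousMap.continuousMapEquiv (1 : C(Y, ℝ))
  have one_apply : ∀ x, one x = 1 := fun x => rfl
  have one_ne : one ≠ 0 := by
    obtain ⟨x, -⟩ := hKne
    intro h0
    have := one_apply x
    simp [h0] at this
  have hp1 : a ≤ p one := by
    refine le_csInf (hne' _) ?_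
    rintro _ ⟨c, hc, rfl⟩
    exact h c hc
  have p_smul : ∀ t : ℝ, 0 < t → ∀ g, p (t • g) = t * p g := fun t ht g =>
    minCost_smul hw ht (hne' g) (hne' (t • g))
  obtain ⟨L, hL1, hLp⟩ := exists_extension_of_le_sublinear
    (LinearPMap.mkSpanSingleton (σ := RingHom.id ℝ) one a one_ne) p p_smul
    (fun g g' => minCost_add_le hw (hne' g) (hne' g')) (by
      rintro ⟨g, hg⟩
      obtain ⟨t, rfl⟩ := Submodule.mem_span_singleton.1 hg
      rw [LinearPMap.mkSpanSingleton'_apply]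
      change t * a ≤ p (t • one)
      rcases le_or_gt t 0 with ht | ht
      · exact (mul_nonpos_of_nonpos_of_nonneg ht ha.le).trans (minCost_nonneg U hw K _)
      · rw [p_smul t ht]
        exact mul_le_mul_of_nonneg_left hp1 ht.le)
  have hLone : L one = a := by
    have := hL1 ⟨one, Submodule.mem_span_singleton_self one⟩
    rw [this]
    exact LinearPMap.mkSpanSingleton_apply ℝ ℝ one_ne a
  let Λ : CompactlySupportedContinuousMap Y ℝ →ₚ[ℝ] ℝ := PositiveLinearMap.mk₀ L (fun g hg => by
    have h1 := hLp (-g)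
    have h2 : p (-g) ≤ 0 := minCost_nonpos U hw fun x _ => by
      have : 0 ≤ g x := hg x
      simpa using this
    rw [map_neg] at h1
    linarith)
  have hΛ : ∀ g, ∫ x, g x ∂(RealRMK.rieszMeasure Λ) = L g := RealRMK.integral_rieszMeasure Λ
  have : (RealRMK.rieszMeasure Λ).Regular := RealRMK.regular_rieszMeasure Λ
  set μ := RealRMK.rieszMeasure Λ with hμ
  have hμuniv : μ univ = ENNReal.ofReal a := by
    have := hΛ one
    rw [hLone] at this
    simp only [one_apply, integral_const, smul_eq_mul, mul_one] at this
    rw [← this, measureReal_def, ENNReal.ofReal_toReal (measure_ne_top _ _)]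
  have key : ∀ V : Set Y, IsOpen V → ∀ b : ℝ,
      (∀ g : C(Y, ℝ), (∀ x, g x ≤ V.indicator (fun _ => (1 : ℝ)) x) → minCost U w K g ≤ b) →
      μ V ≤ ENNReal.ofReal b := by
    intro V hV b hb
    rw [hV.measure_eq_iSup_isCompact]
    refine iSup_le fun F => iSup_le fun hFV => iSup_le fun hF => ?_
    obtain ⟨g, hg0, hg1, hg⟩ := exists_continuous_zero_one_of_isClosed
      hV.isClosed_compl hF.isClosed (disjoint_compl_left_iff_subset.2 hFV)
    let G : CompactlySupportedContinuousMap Y ℝ :=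
      CompactlySupportedContinuousMap.continuousMapEquiv g
    have hle : μ.real F ≤ b := by
      calc μ.real F = ∫ x, F.indicator (fun _ => (1 : ℝ)) x ∂μ := by
            rw [integral_indicator_const _ hF.measurableSet]; simp
        _ ≤ ∫ x, G x ∂μ := by
            refine integral_mono ((integrable_const 1).indicator hF.measurableSet)
              (g.continuous.integrable_of_hasCompactSupport
                (HasCompactSupport.of_compactSpace _)) fun x => ?_
            change _ ≤ g x
            by_cases hx : x ∈ F
            · simpa [hx] using (hg1 hx).ge
            · simpa [hx] using (hg x).1
        _ = L G := hΛ G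
        _ ≤ p G := hLp G
        _ ≤ b := hb g fun x => by
            by_cases hx : x ∈ V
            · simpa [hx] using (hg x).2
            · simpa [hx] using (hg0 hx).le
    rw [← ENNReal.ofReal_toReal (measure_ne_top μ F)]
    exact ENNReal.ofReal_le_ofReal hle
  have ha' : ENNReal.ofReal a ≠ 0 := by simpa using ha
  have hKc : μ Kᶜ = 0 := by
    have := key Kᶜ hK.isClosed.isOpen_compl 0 fun g hg => minCost_nonpos U hw fun x hx => by
      simpa [hx] using hg x
    simpa using this
  have hμK : μ K = ENNReal.ofReal a := by
    rw [← hμuniv, ← measure_add_measure_compl hK.measurableSet, hKc, add_zero]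
  refine ⟨(ENNReal.ofReal a)⁻¹ • μ, ⟨?_⟩, ?_, fun i => ?_⟩
  · rw [Measure.smul_apply, hμuniv, smul_eq_mul, ENNReal.inv_mul_cancel ha' ENNReal.ofReal_ne_top]
  · rw [Measure.smul_apply, hμK, smul_eq_mul, ENNReal.inv_mul_cancel ha' ENNReal.ofReal_ne_top]
  · rw [Measure.smul_apply, smul_eq_mul, mul_comm, ENNReal.ofReal_div_of_pos ha, div_eq_mul_inv]
    gcongr
    exact key _ (hU i) _ fun g hg => minCost_le_of_le_indicator hw i hg

end Frostman

end NDS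

namespace NDS

open scoped NNReal

section ExtendedReal

lemma elog_eq_log : elog = ENNReal.log := rfl

lemma ofENN_eq_coe (x : ℝ≥0∞) : ofENN x = (x : EReal) := by
  rcases eq_or_ne x ⊤ with rfl | hx
  · simp [ofENN]
  · lift x to ℝ≥0 using hx
    rfl

lemma toENN_eq_toENNReal : toENN = EReal.toENNReal := rfl

lemma eInt_eq {α : Type*} [MeasurableSpace α] (μ : Measure α) (g : α → EReal) :
    eInt μ g = ((∫⁻ x, (g x).toENNReal ∂μ : ℝ≥0∞) : EReal)
      - ((∫⁻ x, (-g x).toENNReal ∂μ : ℝ≥0∞) : EReal) := by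
  rw [eInt, ofENN_eq_coe, ofENN_eq_coe, toENN_eq_toENNReal]

lemma eInt_le_of_ae_le {α : Type*} [MeasurableSpace α] (μ : Measure α) [IsProbabilityMeasure μ]
    {g : α → EReal} {b : ℝ} (h : ∀ᵐ x ∂μ, g x ≤ b) : eInt μ g ≤ b := by
  have h1 : ∫⁻ x, (g x).toENNReal ∂μ ≤ ENNReal.ofReal b := by
    calc ∫⁻ x, (g x).toENNReal ∂μ ≤ ∫⁻ _, ENNReal.ofReal b ∂μ :=
          lintegral_mono_ae (h.mono fun x hx => EReal.toENNReal_le_toENNReal hx)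
      _ = _ := by simp
  have h2 : ENNReal.ofReal (-b) ≤ ∫⁻ x, (-g x).toENNReal ∂μ := by
    calc ENNReal.ofReal (-b) = ∫⁻ _, ENNReal.ofReal (-b) ∂μ := by simp
      _ ≤ _ := lintegral_mono_ae (h.mono fun x hx => by
          have : ((-b : ℝ) : EReal) ≤ -g x := by
            rw [EReal.coe_neg]; exact EReal.neg_le_neg_iff.2 hx
          exact EReal.toENNReal_le_toENNReal this)
  rw [eInt_eq]
  calc _ ≤ ((ENNReal.ofReal b : ℝ≥0∞) : EReal) - ((ENNReal.ofReal (-b) : ℝ≥0∞) : EReal) :=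
        EReal.sub_le_sub (by exact_mod_cast h1) (by exact_mod_cast h2)
    _ = b := by
        rw [EReal.coe_ennreal_ofReal, EReal.coe_ennreal_ofReal, ← EReal.coe_sub]
        congr 1
        rcases le_total b 0 with hb | hb <;> simp [hb]

lemma le_eInt_of_forall_le {α : Type*} [MeasurableSpace α] (μ : Measure α)
    [IsProbabilityMeasure μ] {g : α → EReal} {b : ℝ} (h : ∀ x, (b : EReal) ≤ g x) :
    (b : EReal) ≤ eInt μ g := by
  have h1 : ENNReal.ofReal b ≤ ∫⁻ x, (g x).toENNReal ∂μ := by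
    calc ENNReal.ofReal b = ∫⁻ _, ENNReal.ofReal b ∂μ := by simp
      _ ≤ _ := lintegral_mono fun x => EReal.toENNReal_le_toENNReal (h x)
  have h2 : ∫⁻ x, (-g x).toENNReal ∂μ ≤ ENNReal.ofReal (-b) := by
    calc ∫⁻ x, (-g x).toENNReal ∂μ ≤ ∫⁻ _, ENNReal.ofReal (-b) ∂μ :=
          lintegral_mono fun x => by
            have : -g x ≤ ((-b : ℝ) : EReal) := by
              rw [EReal.coe_neg]; exact EReal.neg_le_neg_iff.2 (h x)
            exact EReal.toENNReal_le_toENNReal this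
      _ = _ := by simp
  rw [eInt_eq]
  calc (b : EReal)
      = ((ENNReal.ofReal b : ℝ≥0∞) : EReal) - ((ENNReal.ofReal (-b) : ℝ≥0∞) : EReal) := by
        rw [EReal.coe_ennreal_ofReal, EReal.coe_ennreal_ofReal, ← EReal.coe_sub]
        congr 1
        rcases le_total b 0 with hb | hb <;> simp [hb]
    _ ≤ _ := EReal.sub_le_sub (by exact_mod_cast h1) (by exact_mod_cast h2)

lemma coe_le_inv_mul_neg_elog_add {n : ℕ} {m : ℝ≥0∞} {y S : ℝ}
    (h : m ≤ ENNReal.ofReal (Real.exp y)) :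
    (((n : ℝ)⁻¹ * (S - y) : ℝ) : EReal) ≤
      (((n : ℝ)⁻¹ : ℝ) : EReal) * (-(elog m) + ((S : ℝ) : EReal)) := by
  have h1 : elog m ≤ (y : EReal) := by
    rw [elog_eq_log]
    refine (ENNReal.log_monotone h).trans ?_
    rw [ENNReal.log_ofReal_of_pos (Real.exp_pos y), Real.log_exp]
  have h2 : ((S - y : ℝ) : EReal) ≤ -(elog m) + ((S : ℝ) : EReal) := by
    rw [show S - y = -y + S by ring, EReal.coe_add, EReal.coe_neg]
    exact add_le_add_left (EReal.neg_le_neg_iff.2 h1) _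
  rw [EReal.coe_mul]
  exact mul_le_mul_of_nonneg_left h2 (by exact_mod_cast inv_nonneg.2 (Nat.cast_nonneg n))

lemma le_ofReal_exp_of_le_inv_mul {n : ℕ} (hn : 0 < n) {m : ℝ≥0∞} {b S : ℝ}
    (h : (b : EReal) ≤ (((n : ℝ)⁻¹ : ℝ) : EReal) * (-(elog m) + ((S : ℝ) : EReal))) :
    m ≤ ENNReal.ofReal (Real.exp (-(n : ℝ) * b + S)) := by
  have hn' : (0 : ℝ) < n := Nat.cast_pos.2 hn
  rw [← ENNReal.log_le_log_iff, ENNReal.log_ofReal_of_pos (Real.exp_pos _), Real.log_exp]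
  rw [elog_eq_log] at h
  generalize ENNReal.log m = l at h ⊢
  induction l with
  | bot => simp
  | top =>
    rw [EReal.neg_top, EReal.bot_add, EReal.coe_mul_bot_of_pos (inv_pos.2 hn')] at h
    exact absurd h (by simp)
  | coe l =>
    have h' : b ≤ (n : ℝ)⁻¹ * (-l + S) := by exact_mod_cast h
    rw [inv_mul_eq_div, le_div_iff₀' hn'] at h'
    exact_mod_cast (by linarith : l ≤ -(n : ℝ) * b + S)

end ExtendedReal

section Bowen

variable {X : ℕ → Type*} [∀ k, MetricSpace (X k)]

lemma continuous_iter {T : ∀ k, X k → X (k + 1)} (hT : ∀ k, Continuous (T k)) (j : ℕ) :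
    Continuous (iter T j) := by
  induction j with
  | zero => exact continuous_id
  | succ j ih => exact (hT j).comp ih

lemma isOpen_bowenBall {T : ∀ k, X k → X (k + 1)} (hT : ∀ k, Continuous (T k)) (n : ℕ) (ε : ℝ)
    (x : X 0) : IsOpen (bowenBall T n ε x) := by
  have : bowenBall T n ε x
      = ⋂ j ∈ Set.Iio n, {y | dist (iter T j x) (iter T j y) < ε} := by
    ext y; simp [bowenBall]
  rw [this]
  exact (Set.finite_Iio n).isOpen_biInter fun j _ =>
    isOpen_lt (continuous_const.dist (continuous_iter hT j)) continuous_const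

lemma mem_bowenBall_self (T : ∀ k, X k → X (k + 1)) (n : ℕ) {ε : ℝ} (hε : 0 < ε) (x : X 0) :
    x ∈ bowenBall T n ε x := fun j _ => by simpa using hε

lemma bowenBall_mono (T : ∀ k, X k → X (k + 1)) (n : ℕ) {ε ε' : ℝ} (h : ε ≤ ε') (x : X 0) :
    bowenBall T n ε x ⊆ bowenBall T n ε' x := fun _ hy j hj => (hy j hj).trans_le h

lemma mem_bowenBall_two_mul {T : ∀ k, X k → X (k + 1)} {n : ℕ} {ε : ℝ} {x y z : X 0}
    (hy : y ∈ bowenBall T n ε x) (hz : z ∈ bowenBall T n ε x) :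
    z ∈ bowenBall T n (2 * ε) y := fun j hj => by
  have h1 := hy j hj
  have h2 := hz j hj
  have h3 := dist_triangle_left (iter T j y) (iter T j z) (iter T j x)
  linarith

lemma abs_birk_sub_birk_le {T : ∀ k, X k → X (k + 1)} {f : ∀ k, X k → ℝ} {η δ : ℝ}
    (h : ∀ k, ∀ x y : X k, dist x y < δ → |f k x - f k y| < η) {n : ℕ} {x y : X 0}
    (hy : y ∈ bowenBall T n δ x) : |birk T f n x - birk T f n y| ≤ n * η := by
  rw [birk, birk, ← Finset.sum_sub_distrib]
  refine (Finset.abs_sum_le_sum_abs _ _).trans ?_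
  calc _ ≤ ∑ _j ∈ Finset.range n, η :=
        Finset.sum_le_sum fun j hj => (h j _ _ (hy j (Finset.mem_range.1 hj))).le
    _ = n * η := by simp

lemma bowenPre_anti_radius (T : ∀ k, X k → X (k + 1)) (f : ∀ k, X k → ℝ) (s : ℝ) (N : ℕ)
    {ε ε' : ℝ} (h : ε ≤ ε') (Z : Set (X 0)) :
    bowenPre T f s N ε' Z ≤ bowenPre T f s N ε Z := by
  refine le_iInf₂ fun D hD => le_iInf₂ fun hN hZ => ?_
  exact iInf₂_le_of_le D hD (iInf₂_le_of_le hN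
    (hZ.trans (iUnion₂_mono fun p _ => bowenBall_mono T _ h _)) le_rfl)

lemma bowenPre_anti_exponent (T : ∀ k, X k → X (k + 1)) (f : ∀ k, X k → ℝ) {s s' : ℝ}
    (h : s ≤ s') (N : ℕ) (ε : ℝ) (Z : Set (X 0)) :
    bowenPre T f s' N ε Z ≤ bowenPre T f s N ε Z := by
  refine le_iInf₂ fun D hD => le_iInf₂ fun hN hZ => ?_
  refine iInf₂_le_of_le D hD (iInf₂_le_of_le hN hZ (ENNReal.tsum_le_tsum fun p => ?_))
  refine ENNReal.ofReal_le_ofReal (Real.exp_le_exp.2 ?_)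
  have : (p.1.2 : ℝ) * s ≤ p.1.2 * s' := mul_le_mul_of_nonneg_left h (Nat.cast_nonneg _)
  linarith

lemma le_bowenCrit_of_bowenPre_ne_zero {T : ∀ k, X k → X (k + 1)} {f : ∀ k, X k → ℝ} {s : ℝ}
    {N : ℕ} {ε : ℝ} {Z : Set (X 0)} (h : bowenPre T f s N ε Z ≠ 0) :
    (s : EReal) ≤ bowenCrit T f ε Z := by
  refine le_iInf₂ fun t ht => ?_
  by_contra! hts
  refine h (le_antisymm ?_ bot_le)
  calc bowenPre T f s N ε Z ≤ bowenPre T f t N ε Z :=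
        bowenPre_anti_exponent T f (by exact_mod_cast hts.le) N ε Z
    _ ≤ bowenPreLim T f t ε Z := le_iSup (fun N => bowenPre T f t N ε Z) N
    _ = 0 := ht

lemma exists_bowenPre_ne_zero_of_lt_bowenCrit {T : ∀ k, X k → X (k + 1)} {f : ∀ k, X k → ℝ}
    {s : ℝ} {ε : ℝ} {Z : Set (X 0)} (h : (s : EReal) < bowenCrit T f ε Z) :
    ∃ N, bowenPre T f s N ε Z ≠ 0 := by
  by_contra! h0
  exact h.not_ge (iInf₂_le s (by simp [bowenPreLim, h0]))

/-! ### The measure-theoretic pressure is at most the topological pressure -/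

lemma measure_le_bowenPre [MeasurableSpace (X 0)] (μ : Measure (X 0)) {T : ∀ k, X k → X (k + 1)}
    {f : ∀ k, X k → ℝ} {a b δ ε : ℝ} {N : ℕ} {A K : Set (X 0)} (hAK : A ⊆ K)
    (hεδ : ε ≤ δ)
    (hδ : ∀ k, ∀ x y : X k, dist x y < δ → |f k x - f k y| < b - a)
    (hA : ∀ y ∈ A, ∀ n ≥ N,
      μ (bowenBall T n (2 * ε) y) ≤ ENNReal.ofReal (Real.exp (-(n : ℝ) * b + birk T f n y))) :
    μ A ≤ bowenPre T f a N ε K := by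
  refine le_iInf₂ fun D hD => le_iInf₂ fun hN hK => ?_
  have hcov : A ⊆ ⋃ p ∈ D, A ∩ bowenBall T p.2 ε p.1 := by
    rw [← inter_iUnion₂]
    exact subset_inter subset_rfl (hAK.trans hK)
  refine (measure_mono hcov).trans ((measure_biUnion_le μ hD _).trans
    (ENNReal.tsum_le_tsum fun p => ?_))
  obtain ⟨⟨x, n⟩, hp⟩ := p
  rcases (A ∩ bowenBall T n ε x).eq_empty_or_nonempty with h0 | ⟨y, hyA, hy⟩
  · simp [h0]
  calc μ (A ∩ bowenBall T n ε x) ≤ μ (bowenBall T n (2 * ε) y) :=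
        measure_mono fun z hz => mem_bowenBall_two_mul hy hz.2
    _ ≤ _ := hA y hyA n (hN _ hp)
    _ ≤ _ := by
      refine ENNReal.ofReal_le_ofReal (Real.exp_le_exp.2 ?_)
      have := abs_birk_sub_birk_le hδ (bowenBall_mono T n hεδ x hy)
      have := neg_abs_le (birk T f n x - birk T f n y)
      dsimp only
      linarith

lemma lowerPres_le_bowenP [MeasurableSpace (X 0)] {μ : Measure (X 0)} [IsProbabilityMeasure μ]
    {T : ∀ k, X k → X (k + 1)} {f : ∀ k, X k → ℝ} (hfe : EquicontPotential f) {K : Set (X 0)}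
    (hK : ∀ᵐ x ∂μ, x ∈ K) : lowerPres μ T f ≤ bowenP T f K := by
  by_contra! hlt
  obtain ⟨a, ha, ha'⟩ := EReal.lt_iff_exists_real_btwn.1 hlt
  obtain ⟨b, hab, hb⟩ := EReal.lt_iff_exists_real_btwn.1 ha'
  have hab : a < b := by exact_mod_cast hab
  let A : ℕ × ℕ → Set (X 0) := fun p => {x | x ∈ K ∧ ∀ n ≥ p.2,
    μ (bowenBall T n (1 / (p.1 + 1)) x) ≤
      ENNReal.ofReal (Real.exp (-(n : ℝ) * b + birk T f n x))}
  have hex : ∃ p, μ (A p) ≠ 0 := by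
    by_contra! h0
    refine hb.not_ge (eInt_le_of_ae_le μ ?_)
    have hA0 : ∀ᵐ x ∂μ, x ∉ ⋃ p, A p := measure_eq_zero_iff_ae_notMem.1 (measure_iUnion_null h0)
    filter_upwards [hA0, hK] with x hx hxK
    by_contra! hbx
    obtain ⟨ε, hbx⟩ := lt_iSup_iff.1 hbx
    obtain ⟨hε, hbx⟩ := lt_iSup_iff.1 hbx
    obtain ⟨N, hN⟩ := eventually_atTop.1 (eventually_lt_of_lt_liminf hbx)
    obtain ⟨m, hm⟩ := exists_nat_one_div_lt hε
    refine hx (mem_iUnion.2 ⟨(m, N + 1), hxK, fun n hn => ?_⟩)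
    have hn : N + 1 ≤ n := hn
    exact (measure_mono (bowenBall_mono T n hm.le x)).trans
      (le_ofReal_exp_of_le_inv_mul (by lia) (hN n (by lia)).le)
  obtain ⟨⟨m, N⟩, hA⟩ := hex
  obtain ⟨δ, hδ0, hδ⟩ := hfe (b - a) (sub_pos.2 hab)
  have hm : (0 : ℝ) < 1 / (m + 1) := by positivity
  let ε := min δ (1 / ((m : ℝ) + 1) / 2)
  have hε : 0 < ε := lt_min hδ0 (by linarith)
  have hε2 : 2 * ε ≤ 1 / ((m : ℝ) + 1) := by
    have : ε ≤ 1 / ((m : ℝ) + 1) / 2 := min_le_right _ _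
    linarith
  have hle : μ (A (m, N)) ≤ bowenPre T f a N ε K :=
    measure_le_bowenPre μ (fun x hx => hx.1) (min_le_left _ _) hδ fun y hy n hn =>
      (measure_mono (bowenBall_mono T n hε2 y)).trans (hy.2 n hn)
  have hne : bowenPre T f a N ε K ≠ 0 := fun h0 => hA (le_antisymm (h0 ▸ hle) bot_le)
  exact ha.not_ge ((le_bowenCrit_of_bowenPre_ne_zero hne).trans
    (le_iSup₂ (f := fun ε (_ : 0 < ε) => bowenCrit T f ε K) ε hε))

end Bowen

end NDS

namespace NDS

open scoped NNReal

section Covering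

/-- A greedy selection: if the family `U i`, `i ∈ I`, with weights `c i` has total weight at least
`t` on `Z`, then `Z` is covered by finitely many of the sets `V z`, each of which contains every
`U i` through `z`, at a cost controlled by that of the weighted family. -/
lemma exists_finset_cover_of_le_sum {Y ι : Type*} {U : ι → Set Y} {V : Y → Set Y}
    (hUV : ∀ i, ∀ z ∈ U i, U i ⊆ V z) {c u : ι → ℝ} (hc : ∀ i, 0 ≤ c i) (hu : ∀ i, 0 ≤ u i)
    {v : Y → ℝ} (hvu : ∀ i, ∀ z ∈ U i, v z ≤ u i) {t : ℝ} (ht : 0 < t) (I : Finset ι) :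
    ∀ Z : Set Y, (∀ z ∈ Z, t ≤ ∑ i ∈ I, c i * (U i).indicator (fun _ => (1 : ℝ)) z) →
      ∃ J : Finset Y, Z ⊆ ⋃ z ∈ J, V z ∧ t * ∑ z ∈ J, v z ≤ ∑ i ∈ I, c i * u i := by
  classical
  induction I using Finset.strongInduction with
  | H I ih =>
    intro Z hZ
    rcases Z.eq_empty_or_nonempty with rfl | ⟨z, hz⟩
    · exact ⟨∅, by simp, by simpa using Finset.sum_nonneg fun i _ => mul_nonneg (hc i) (hu i)⟩
    have hsum : t ≤ ∑ i ∈ I with z ∈ U i, c i := by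
      simpa [Finset.sum_filter, indicator_apply] using hZ z hz
    have hss : I.filter (fun i => z ∉ U i) ⊂ I := by
      rw [Finset.filter_ssubset]
      by_contra! h
      rw [Finset.filter_false_of_mem h] at hsum
      simp only [Finset.sum_empty] at hsum
      linarith
    obtain ⟨J, hJ, hJsum⟩ := ih _ hss (Z \ V z) fun z' hz' => by
      rw [Finset.sum_filter_of_ne]
      · exact hZ z' hz'.1
      · intro i _ hi hzi
        refine hi ?_
        rw [indicator_of_notMem fun h => hz'.2 (hUV i z hzi h), mul_zero]
    refine ⟨insert z J, fun y hy => ?_, ?_⟩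
    · by_cases hyz : y ∈ V z
      · exact mem_iUnion₂.2 ⟨z, by simp, hyz⟩
      · obtain ⟨z', hz', hy'⟩ := mem_iUnion₂.1 (hJ ⟨hy, hyz⟩)
        exact mem_iUnion₂.2 ⟨z', by simp [hz'], hy'⟩
    · have hz' : t * v z ≤ ∑ i ∈ I with z ∈ U i, c i * u i := by
        rcases le_or_gt (v z) 0 with hv | hv
        · exact (mul_nonpos_of_nonneg_of_nonpos ht.le hv).trans
            (Finset.sum_nonneg fun i _ => mul_nonneg (hc i) (hu i))
        calc t * v z ≤ (∑ i ∈ I with z ∈ U i, c i) * v z :=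
              mul_le_mul_of_nonneg_right hsum hv.le
          _ = ∑ i ∈ I with z ∈ U i, c i * v z := Finset.sum_mul _ _ _
          _ ≤ _ := Finset.sum_le_sum fun i hi =>
              mul_le_mul_of_nonneg_left (hvu i z (Finset.mem_filter.1 hi).2) (hc i)
      have hsplit := Finset.sum_filter_add_sum_filter_not I (fun i => z ∈ U i)
        (fun i => c i * u i)
      by_cases hzJ : z ∈ J
      · rw [Finset.insert_eq_of_mem hzJ]
        have : 0 ≤ ∑ i ∈ I with z ∈ U i, c i * u i :=
          Finset.sum_nonneg fun i _ => mul_nonneg (hc i) (hu i)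
        linarith
      · rw [Finset.sum_insert hzJ, mul_add]
        linarith

/-- If the terms of a finite sum have total at least `1`, some level set of `ℓ` contributes at
least the corresponding term of the geometric probability distribution. -/
lemma exists_geometric_le_sum_level {ι : Type*} (S : Finset ι) (ℓ : ι → ℕ) (a : ι → ℝ)
    (h : 1 ≤ ∑ i ∈ S, a i) {r : ℝ} (hr0 : 0 < r) (hr1 : r < 1) :
    ∃ n ∈ S.image ℓ, (1 - r) * r ^ n ≤ ∑ i ∈ S with ℓ i = n, a i := by
  by_contra! hlt
  have hS : S.Nonempty := by
    by_contra hS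
    rw [Finset.not_nonempty_iff_eq_empty] at hS
    simp [hS] at h
    linarith
  have h1 : ∑ n ∈ S.image ℓ, ∑ i ∈ S with ℓ i = n, a i = ∑ i ∈ S, a i :=
    Finset.sum_fiberwise_of_maps_to (fun i hi => Finset.mem_image_of_mem ℓ hi) a
  have h2 : ∑ n ∈ S.image ℓ, ∑ i ∈ S with ℓ i = n, a i < ∑ n ∈ S.image ℓ, (1 - r) * r ^ n :=
    Finset.sum_lt_sum_of_nonempty (hS.image ℓ) hlt
  have h3 : ∑ n ∈ S.image ℓ, (1 - r) * r ^ n ≤ 1 := by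
    have hs : HasSum (fun n : ℕ => (1 - r) * r ^ n) 1 := by
      have := (hasSum_geometric_of_lt_one hr0.le hr1).mul_left (1 - r)
      rwa [mul_inv_cancel₀ (sub_pos.2 hr1).ne'] at this
    exact sum_le_hasSum _ (fun n _ => mul_nonneg (sub_pos.2 hr1).le (pow_nonneg hr0.le n)) hs
  linarith

end Covering

section Bowen

variable {X : ℕ → Type*} [∀ k, MetricSpace (X k)]

lemma bowenPre_le_sum {T : ∀ k, X k → X (k + 1)} {f : ∀ k, X k → ℝ} {s ε : ℝ} {N : ℕ}
    {K : Set (X 0)} (L : Finset ℕ) (hL : ∀ n ∈ L, N ≤ n) (J : ℕ → Finset (X 0))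
    (hK : K ⊆ ⋃ n ∈ L, ⋃ z ∈ J n, bowenBall T n ε z) :
    bowenPre T f s N ε K ≤
      ENNReal.ofReal (∑ n ∈ L, ∑ z ∈ J n, Real.exp (-(n : ℝ) * s + birk T f n z)) := by
  classical
  let D : Finset (X 0 × ℕ) := (L.sigma J).image fun q => (q.2, q.1)
  have hD : ∀ p : X 0 × ℕ, p ∈ D ↔ p.2 ∈ L ∧ p.1 ∈ J p.2 := by
    rintro ⟨z, n⟩
    simp only [D, Finset.mem_image, Finset.mem_sigma, Prod.mk.injEq, Sigma.exists]
    constructor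
    · rintro ⟨m, y, h, rfl, rfl⟩; exact h
    · intro h; exact ⟨n, z, h, rfl, rfl⟩
  refine iInf₂_le_of_le (D : Set (X 0 × ℕ)) D.countable_toSet
    (iInf₂_le_of_le (fun p hp => hL _ ((hD p).1 hp).1) (fun x hx => ?_) ?_)
  · obtain ⟨n, hn, hx⟩ := mem_iUnion₂.1 (hK hx)
    obtain ⟨z, hz, hx⟩ := mem_iUnion₂.1 hx
    exact mem_iUnion₂.2 ⟨(z, n), (hD (z, n)).2 ⟨hn, hz⟩, hx⟩
  · refine le_of_eq ?_
    rw [Finset.sum_sigma', ENNReal.ofReal_sum_of_nonneg fun _ _ => (Real.exp_pos _).le]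
    refine (D.tsum_subtype fun p : X 0 × ℕ =>
      ENNReal.ofReal (Real.exp (-(p.2 : ℝ) * s + birk T f p.2 p.1))).trans ?_
    refine Finset.sum_image ?_
    rintro ⟨n, z⟩ - ⟨n', z'⟩ - h
    obtain ⟨rfl, rfl⟩ := Prod.mk.inj h
    rfl

/-- The Bowen premeasure is controlled by the cost of finite weighted covers. -/
lemma bowenPre_le_weightCost {T : ∀ k, X k → X (k + 1)} {f : ∀ k, X k → ℝ} {s η δ ε : ℝ}
    {N : ℕ} {K : Set (X 0)} (hη : 0 < η) (hεδ : ε ≤ δ)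
    (hδ : ∀ k, ∀ x y : X k, dist x y < δ → |f k x - f k y| < η)
    (c : {p : X 0 × ℕ // N ≤ p.2} →₀ ℝ≥0)
    (hc : ∀ x ∈ K, 1 ≤ weightAt (fun p => bowenBall T p.1.2 ε p.1.1) c x) :
    bowenPre T f (s + 2 * η) N (2 * ε) K ≤ ENNReal.ofReal ((1 - Real.exp (-η))⁻¹ *
      weightCost (fun p => Real.exp (-(p.1.2 : ℝ) * s + birk T f p.1.2 p.1.1)) c) := by
  classical
  set r := Real.exp (-η) with hr
  have hr0 : 0 < r := Real.exp_pos _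
  have hr1 : r < 1 := Real.exp_lt_one_iff.2 (by linarith)
  let ℓ : {p : X 0 × ℕ // N ≤ p.2} → ℕ := fun p => p.1.2
  let U : {p : X 0 × ℕ // N ≤ p.2} → Set (X 0) := fun p => bowenBall T p.1.2 ε p.1.1
  let w : {p : X 0 × ℕ // N ≤ p.2} → ℝ :=
    fun p => Real.exp (-(p.1.2 : ℝ) * s + birk T f p.1.2 p.1.1)
  let L : Finset ℕ := c.support.image ℓ
  let Z : ℕ → Set (X 0) := fun n => {x | (1 - r) * r ^ n ≤
    ∑ i ∈ c.support with ℓ i = n, (c i : ℝ) * (U i).indicator (fun _ => (1 : ℝ)) x}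
  have hKZ : ∀ x ∈ K, ∃ n ∈ L, x ∈ Z n := fun x hx => by
    have := hc x hx
    rw [weightAt_eq_sum] at this
    exact exists_geometric_le_sum_level c.support ℓ _ this hr0 hr1
  have hlevel : ∀ n, ∃ J : Finset (X 0), Z n ⊆ ⋃ z ∈ J, bowenBall T n (2 * ε) z ∧
      (1 - r) * ∑ z ∈ J, Real.exp (-(n : ℝ) * (s + 2 * η) + birk T f n z) ≤
        ∑ i ∈ c.support with ℓ i = n, (c i : ℝ) * w i := by
    intro n
    have hrn : 0 < r ^ n := pow_pos hr0 n
    obtain ⟨J, hJ, hJs⟩ := exists_finset_cover_of_le_sum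
      (ι := {i : {p : X 0 × ℕ // N ≤ p.2} // ℓ i = n})
      (U := fun i => U i.1) (V := fun z => bowenBall T n (2 * ε) z)
      (by
        rintro ⟨⟨⟨x, m⟩, hm⟩, rfl⟩ z hz y hy
        exact mem_bowenBall_two_mul hz hy)
      (c := fun i => c i.1) (u := fun i => w i.1)
      (v := fun z => Real.exp (-(n : ℝ) * (s + η) + birk T f n z))
      (fun i => (c i.1).2) (fun i => (Real.exp_pos _).le)
      (by
        rintro ⟨⟨⟨x, m⟩, hm⟩, rfl⟩ z hz
        refine Real.exp_le_exp.2 ?_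
        have h1 := abs_birk_sub_birk_le hδ (bowenBall_mono T m hεδ x hz)
        have h2 := neg_abs_le (birk T f m x - birk T f m z)
        dsimp only [ℓ]
        linarith)
      (mul_pos (sub_pos.2 hr1) hrn) (c.support.subtype fun i => ℓ i = n) (Z n)
      (fun z hz => by
        simp only [Z, mem_ofPred_eq, ← Finset.sum_subtype_eq_sum_filter] at hz
        exact hz)
    refine ⟨J, hJ, ?_⟩
    rw [Finset.sum_subtype_eq_sum_filter (f := fun i => (c i : ℝ) * w i)] at hJs
    rw [mul_assoc, Finset.mul_sum] at hJs
    convert hJs using 3 with z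
    rw [hr, ← Real.exp_nat_mul, ← Real.exp_add]
    congr 1
    ring
  choose J hJ hJs using hlevel
  refine (bowenPre_le_sum L (fun n hn => ?_) J fun x hx => ?_).trans
    (ENNReal.ofReal_le_ofReal ?_)
  · obtain ⟨i, -, rfl⟩ := Finset.mem_image.1 hn
    exact i.2
  · obtain ⟨n, hn, hxn⟩ := hKZ x hx
    exact mem_iUnion₂.2 ⟨n, hn, hJ n hxn⟩
  · rw [inv_mul_eq_div, le_div_iff₀' (sub_pos.2 hr1), weightCost_eq_sum, Finset.mul_sum]
    refine (Finset.sum_le_sum fun n _ => hJs n).trans (le_of_eq ?_)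
    exact Finset.sum_fiberwise_of_maps_to (fun i hi => Finset.mem_image_of_mem ℓ hi) _

/-! ### The topological pressure is at most the supremum of the measure-theoretic ones -/

lemma le_localLowerPres_of_measure_le [MeasurableSpace (X 0)] {μ : Measure (X 0)}
    {T : ∀ k, X k → X (k + 1)} {f : ∀ k, X k → ℝ} {s a ε : ℝ} (ha : 0 < a) (hε : 0 < ε) {N : ℕ}
    {x : X 0} (h : ∀ n ≥ N, μ (bowenBall T n ε x) ≤
      ENNReal.ofReal (Real.exp (-(n : ℝ) * s + birk T f n x) / a)) :
    (s : EReal) ≤ localLowerPres μ T f x := by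
  refine le_iSup₂_of_le ε hε ?_
  have hlim : Tendsto (fun n : ℕ => s + (n : ℝ)⁻¹ * Real.log a) atTop (𝓝 s) := by
    simpa using (tendsto_inv_atTop_nhds_zero_nat (𝕜 := ℝ)).mul_const (Real.log a) |>.const_add s
  have hlim' := (continuous_coe_real_ereal.tendsto s).comp hlim
  rw [← hlim'.liminf_eq]
  refine liminf_le_liminf ?_
  filter_upwards [eventually_ge_atTop (N + 1)] with n hn
  have hn0 : (n : ℝ) ≠ 0 := Nat.cast_ne_zero.2 (by lia)
  have h1 := h n (by lia)
  rw [show Real.exp (-(n : ℝ) * s + birk T f n x) / a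
      = Real.exp (-(n : ℝ) * s + birk T f n x - Real.log a) by
    rw [Real.exp_sub, Real.exp_log ha]] at h1
  refine le_trans (le_of_eq ?_) (coe_le_inv_mul_neg_elog_add h1)
  simp only [Function.comp_apply]
  congr 1
  field_simp
  ring

lemma exists_le_lowerPres [CompactSpace (X 0)] [MeasurableSpace (X 0)] [BorelSpace (X 0)]
    {T : ∀ k, X k → X (k + 1)} (hT : ∀ k, Continuous (T k)) {f : ∀ k, X k → ℝ}
    (hfe : EquicontPotential f) {K : Set (X 0)} (hK : IsCompact K) {s η : ℝ} (hη : 0 < η)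
    (hs : ((s + 2 * η : ℝ) : EReal) < bowenP T f K) :
    ∃ μ : Measure (X 0), (IsProbabilityMeasure μ ∧ μ K = 1) ∧ (s : EReal) ≤ lowerPres μ T f := by
  obtain ⟨ε₀, hs⟩ := lt_iSup_iff.1 hs
  obtain ⟨hε₀, hs⟩ := lt_iSup_iff.1 hs
  obtain ⟨N, hN⟩ := exists_bowenPre_ne_zero_of_lt_bowenCrit hs
  obtain ⟨δ, hδ0, hδ⟩ := hfe η hη
  let ε := min δ (ε₀ / 2)
  have hε : 0 < ε := lt_min hδ0 (by linarith)
  have hε2 : 2 * ε ≤ ε₀ := by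
    have : ε ≤ ε₀ / 2 := min_le_right _ _
    linarith
  have hpos : 0 < bowenPre T f (s + 2 * η) N (2 * ε) K :=
    (pos_iff_ne_zero.2 hN).trans_le (bowenPre_anti_radius T f _ N hε2 K)
  obtain ⟨m, hm0, hm⟩ := ENNReal.lt_iff_exists_real_btwn.1 hpos |>.imp fun m h => h.2
  rw [ENNReal.ofReal_pos] at hm0
  have hr : 0 < 1 - Real.exp (-η) := sub_pos.2 (Real.exp_lt_one_iff.2 (by linarith))
  have ha : 0 < (1 - Real.exp (-η)) * m := mul_pos hr hm0
  obtain ⟨μ, hμ, hμK, hμU⟩ := exists_measure_le_of_le_weightCost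
    (U := fun p : {p : X 0 × ℕ // N ≤ p.2} => bowenBall T p.1.2 ε p.1.1)
    (w := fun p => Real.exp (-(p.1.2 : ℝ) * s + birk T f p.1.2 p.1.1))
    (fun p => isOpen_bowenBall hT _ _ _) (fun p => (Real.exp_pos _).le) hK
    (fun x _ => mem_iUnion.2 ⟨⟨(x, N), le_rfl⟩, mem_bowenBall_self T N hε x⟩) ha
    (fun c hc => by
      have h1 := hm.le.trans (bowenPre_le_weightCost (s := s) hη (min_le_left _ _) hδ c hc)
      rw [ENNReal.ofReal_le_ofReal_iff (mul_nonneg (inv_nonneg.2 hr.le)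
        (weightCost_nonneg (fun p => (Real.exp_pos _).le) c)), inv_mul_eq_div,
        le_div_iff₀' hr] at h1
      exact h1)
  exact ⟨μ, ⟨hμ, hμK⟩, le_eInt_of_forall_le μ fun x =>
    le_localLowerPres_of_measure_le ha hε fun n hn => hμU ⟨(x, n), hn⟩⟩

end Bowen

end NDS

open NDS in
/-- Variational principle for the Bowen pressure.
For a non-empty compact `K ⊆ X 0` and an equicontinuous sequence of potentials `f`,
`P^B(T,f,K) = sup { P̲_μ(T,f) : μ Borel probability measure on X 0 with μ(K) = 1 }`. -/
theorem stmt2 {X : ℕ → Type*} [∀ k, MetricSpace (X k)] [∀ k, CompactSpace (X k)]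
    [MeasurableSpace (X 0)] [BorelSpace (X 0)]
    (T : ∀ k, X k → X (k + 1)) (hT : ∀ k, Continuous (T k))
    (f : ∀ k, X k → ℝ) (hf : ∀ k, Continuous (f k)) (hfe : EquicontPotential f)
    (K : Set (X 0)) (hK : IsCompact K) (hKne : K.Nonempty) :
    bowenP T f K =
      ⨆ (μ : MeasureTheory.Measure (X 0))
        (_ : MeasureTheory.IsProbabilityMeasure μ ∧ μ K = 1), lowerPres μ T f := by
  refine le_antisymm (le_of_forall_lt fun b hb => ?_) ?_
  · obtain ⟨t, hbt, ht⟩ := EReal.lt_iff_exists_real_btwn.1 hb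
    obtain ⟨u, htu, hu⟩ := EReal.lt_iff_exists_real_btwn.1 ht
    have htu : t < u := by exact_mod_cast htu
    obtain ⟨μ, hμ, hle⟩ := exists_le_lowerPres hT hfe hK (s := t) (η := (u - t) / 2)
      (by linarith) (by rwa [show t + 2 * ((u - t) / 2) = u by ring])
    exact hbt.trans_le (hle.trans (le_iSup₂ (f := fun (μ : Measure (X 0))
      (_ : IsProbabilityMeasure μ ∧ μ K = 1) => lowerPres μ T f) μ hμ))
  · refine iSup₂_le fun μ hμ => ?_
    have := hμ.1
    exact lowerPres_le_bowenP hfe (mem_ae_iff_prob_eq_one hK.measurableSet |>.2 hμ.2)
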